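/- Let g ∈ ℤ[x] be x²-divisible of degree d with leading coefficient u_d, and let c ∈ ℚ. For every n ≥ 0 and every prime p, if p ∈ I(B_n) (i.e. val_p(B_n) > val_p(u_d)), then p ∈ I(B_{n+1}) and val_p(B_{n+1}) = d·val_p(B_n) − val_p(u_d). -/

import Mathlib

open Polynomial

/-- The `n`-th iterate of `g_c := g + c` applied to `0`, for `g ∈ ℤ[x]` and `c ∈ ℚ`. -/
noncomputable def gcIter (g : ℤ[X]) (c : ℚ) (n : ℕ) : ℚ :=
  (fun x : ℚ => (g.map (Int.castRingHom ℚ)).eval x + c)^[n] 0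

/-- `g` is `x²`-divisible: degree at least 2 and zero constant and linear coefficients. -/
def IsX2Divisible (g : ℤ[X]) : Prop :=
  2 ≤ g.natDegree ∧ g.coeff 0 = 0 ∧ g.coeff 1 = 0

/-- The length `L_g = 1 + ∑_{i=2}^{d-1} |u_i|/|u_d|` of an `x²`-divisible polynomial. -/
noncomputable def Lg (g : ℤ[X]) : ℝ :=
  1 + ∑ i ∈ Finset.Ico 2 g.natDegree, (|g.coeff i| : ℝ) / (|g.leadingCoeff| : ℝ)

/-- `S_g`: the set of `c ∈ ℚ` such that the sequence `{g_c^n(0)}_{n ≥ 1}` takes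
infinitely many values. -/
def Sg (g : ℤ[X]) : Set ℚ :=
  {c : ℚ | (Set.range fun n : ℕ => gcIter g c (n + 1)).Infinite}

/-- The numerator `A_n` of `g_c^{n+1}(0) = g_c^n(c) = A_n / B_n` in lowest terms. -/
noncomputable def An (g : ℤ[X]) (c : ℚ) (n : ℕ) : ℤ := (gcIter g c (n + 1)).num

/-- The (positive) denominator `B_n` of `g_c^{n+1}(0) = g_c^n(c) = A_n / B_n`
in lowest terms. -/
noncomputable def Bn (g : ℤ[X]) (c : ℚ) (n : ℕ) : ℕ := (gcIter g c (n + 1)).den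

/-- For a natural number `a`, the factor `â = ∏_{p ∈ I(a)} p^{val_p(a)}`, where
`I(a)` consists of the primes `p` with `val_p(a) > val_p(u_d)`. -/
noncomputable def hatB (g : ℤ[X]) (a : ℕ) : ℕ :=
  ∏ p ∈ a.primeFactors.filter
      (fun p => padicValInt p g.leadingCoeff < padicValNat p a),
    p ^ padicValNat p a

/-- `g` has rapidly increasing numerators on `S`: there is an integer `N > 0` such that
for every `c ∈ S` there is a finite set `J_c ⊆ ℕ` with `#J_c ≤ N` such that for every
`n ≥ 1` outside `J_c` one has `ln |A_n| > ∑_{p ∣ n} ln |A_{n/p}|`. -/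
def RapidlyIncreasingNumerators (g : ℤ[X]) (S : Set ℚ) : Prop :=
  ∃ N : ℕ, 0 < N ∧ ∀ c ∈ S, ∃ J : Finset ℕ, J.card ≤ N ∧
    ∀ n : ℕ, 1 ≤ n → n ∉ J →
      (∑ p ∈ n.primeFactors, Real.log |(An g c (n / p) : ℝ)|) <
        Real.log |(An g c n : ℝ)|

/-- The `p`-adic norm of a rational number is at most `p` to the valuation of its denominator. -/
theorem padicNorm_le_pow_padicValNat_den (p : ℕ) [Fact p.Prime] (x : ℚ) :
    padicNorm p x ≤ (p : ℚ) ^ padicValNat p x.den := by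
  have hp1 : (1 : ℚ) ≤ p := by exact_mod_cast (Fact.out : p.Prime).one_le
  by_cases hx : x = 0
  · simp [hx]
  · rw [padicNorm.eq_zpow_of_nonzero hx, padicValRat.eq_1, ← zpow_natCast]
    exact zpow_le_zpow_right₀ hp1 (by omega)

/-- If `p` divides the denominator of `x`, the `p`-adic norm of `x` is `p` to the valuation of
the denominator. -/
theorem padicNorm_eq_pow_padicValNat_den (p : ℕ) [Fact p.Prime] {x : ℚ}
    (hx : 0 < padicValNat p x.den) :
    padicNorm p x = (p : ℚ) ^ padicValNat p x.den := by
  have hx0 : x ≠ 0 := by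
    rintro rfl
    simp at hx
  have hdvd : p ∣ x.den := dvd_of_one_le_padicValNat hx
  have hnum : padicValInt p x.num = 0 := by
    refine padicValNat.eq_zero_of_not_dvd fun hn => ?_
    have := Nat.dvd_gcd hn hdvd
    rw [x.reduced] at this
    exact (Fact.out : p.Prime).one_lt.ne' (Nat.dvd_one.mp this)
  rw [padicNorm.eq_zpow_of_nonzero hx0, padicValRat.eq_1, hnum, ← zpow_natCast]
  simp

/-- A rational number of `p`-adic norm `p ^ k` with `k > 0` has denominator of valuation `k`. -/
theorem padicValNat_den_eq_of_padicNorm_eq (p : ℕ) [Fact p.Prime] {x : ℚ} {k : ℤ} (hk : 0 < k)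
    (hx : padicNorm p x = (p : ℚ) ^ k) : (padicValNat p x.den : ℤ) = k := by
  have hp1 : (1 : ℚ) < p := by exact_mod_cast (Fact.out : p.Prime).one_lt
  have hpos : 0 < padicValNat p x.den := by
    by_contra h0
    have hle := padicNorm_le_pow_padicValNat_den p x
    rw [Nat.eq_zero_of_not_pos h0, pow_zero, hx] at hle
    exact (one_lt_zpow₀ hp1 hk).not_ge hle
  rw [padicNorm_eq_pow_padicValNat_den p hpos, ← zpow_natCast] at hx
  exact zpow_right_injective₀ (by positivity) hp1.ne' hx

/-- If the valuation of the denominator of `x` exceeds that of the leading coefficient of `g` and is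
at least that of the denominator of `c`, then the leading term dominates `g(x) + c`. -/
theorem padicNorm_eval_add_eq (p : ℕ) [Fact p.Prime] (g : ℤ[X]) (hg : 2 ≤ g.natDegree) {x c : ℚ}
    (hx : padicValInt p g.leadingCoeff < padicValNat p x.den)
    (hc : padicValNat p c.den ≤ padicValNat p x.den) :
    padicNorm p ((g.map (Int.castRingHom ℚ)).eval x + c) =
      (p : ℚ) ^ ((g.natDegree : ℤ) * padicValNat p x.den - padicValInt p g.leadingCoeff) := by
  have hp1 : (1 : ℚ) < p := by exact_mod_cast (Fact.out : p.Prime).one_lt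
  have hp0 : (0 : ℚ) < p := by linarith
  obtain ⟨k, hk⟩ : ∃ k, g.natDegree = k + 1 := ⟨g.natDegree - 1, by omega⟩
  have hu : g.leadingCoeff ≠ 0 := by
    rw [Ne, leadingCoeff_eq_zero]
    rintro rfl
    simp at hg
  have hxn := padicNorm_eq_pow_padicValNat_den p (Nat.zero_lt_of_lt hx)
  set b := padicValNat p x.den
  set e := padicValInt p g.leadingCoeff
  have hlead : padicNorm p ((g.leadingCoeff : ℚ) * x ^ g.natDegree) =
      (p : ℚ) ^ ((g.natDegree : ℤ) * b - e) := by
    rw [padicNorm.mul, padicNorm.eq_zpow_of_nonzero (by exact_mod_cast hu), padicValRat.of_int,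
      IsAbsoluteValue.abv_pow (padicNorm p), hxn, ← pow_mul, ← zpow_natCast, ← zpow_add₀ hp0.ne']
    congr 1
    push_cast
    ring
  have hsum : padicNorm p (∑ i ∈ Finset.range g.natDegree, (g.coeff i : ℚ) * x ^ i) ≤
      (p : ℚ) ^ (k * b) := by
    refine padicNorm.sum_le' (fun i hi => ?_) (by positivity)
    have hik : i ≤ k := by
      have := Finset.mem_range.mp hi
      omega
    rw [padicNorm.mul, IsAbsoluteValue.abv_pow (padicNorm p), hxn, ← pow_mul, mul_comm b]
    exact (mul_le_of_le_one_left (by positivity) (padicNorm.of_int _)).trans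
      (pow_le_pow_right₀ hp1.le (Nat.mul_le_mul_right b hik))
  have hcn : padicNorm p c ≤ (p : ℚ) ^ (k * b) :=
    (padicNorm_le_pow_padicValNat_den p c).trans
      (pow_le_pow_right₀ hp1.le (hc.trans (Nat.le_mul_of_pos_left _ (by omega))))
  have hrest := (padicNorm.nonarchimedean (p := p)).trans (max_le hsum hcn)
  have hlt : (p : ℚ) ^ (k * b) < (p : ℚ) ^ ((g.natDegree : ℤ) * b - e) := by
    rw [← zpow_natCast]
    refine zpow_lt_zpow_right₀ hp1 ?_
    rw [hk]
    push_cast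
    linarith [(by exact_mod_cast hx : (e : ℤ) < b)]
  have heval : (g.map (Int.castRingHom ℚ)).eval x + c =
      (g.leadingCoeff : ℚ) * x ^ g.natDegree +
        (∑ i ∈ Finset.range g.natDegree, (g.coeff i : ℚ) * x ^ i + c) := by
    rw [eval_map, eval₂_eq_sum_range, Finset.sum_range_succ]
    simp only [eq_intCast, coeff_natDegree]
    ring
  rw [heval, padicNorm.add_eq_max_of_ne (by rw [hlead]; exact (hrest.trans_lt hlt).ne'), hlead,
    max_eq_left (hrest.trans hlt.le)]

/-- The valuation of the denominator of `g(x) + c`, when the leading term dominates. -/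
theorem padicValNat_den_eval_add (p : ℕ) [Fact p.Prime] (g : ℤ[X]) (hg : 2 ≤ g.natDegree)
    {x c : ℚ} (hx : padicValInt p g.leadingCoeff < padicValNat p x.den)
    (hc : padicValNat p c.den ≤ padicValNat p x.den) :
    padicValNat p x.den < padicValNat p ((g.map (Int.castRingHom ℚ)).eval x + c).den ∧
    (padicValNat p ((g.map (Int.castRingHom ℚ)).eval x + c).den : ℤ) =
      (g.natDegree : ℤ) * padicValNat p x.den - padicValInt p g.leadingCoeff := by
  have hlt : (padicValNat p x.den : ℤ) <
      (g.natDegree : ℤ) * padicValNat p x.den - padicValInt p g.leadingCoeff := by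
    have hmul : 2 * padicValNat p x.den ≤ g.natDegree * padicValNat p x.den :=
      Nat.mul_le_mul_right _ hg
    rw [← Nat.cast_mul]
    omega
  have heq := padicValNat_den_eq_of_padicNorm_eq p (by omega) (padicNorm_eval_add_eq p g hg hx hc)
  exact ⟨by omega, heq⟩

theorem gcIter_succ (g : ℤ[X]) (c : ℚ) (n : ℕ) :
    gcIter g c (n + 1) = (g.map (Int.castRingHom ℚ)).eval (gcIter g c n) + c :=
  Function.iterate_succ_apply' _ _ _

/-- If `val_p(c)` is below `-val_p(u_d)`, the valuations of the denominators of the iterates never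
drop below that of `c`. -/
theorem padicValNat_den_le_Bn (p : ℕ) [Fact p.Prime] (g : ℤ[X]) (hg : IsX2Divisible g) {c : ℚ}
    (hc : padicValInt p g.leadingCoeff < padicValNat p c.den) (n : ℕ) :
    padicValNat p c.den ≤ padicValNat p (Bn g c n) := by
  induction n with
  | zero => simp [Bn, gcIter, eval_map, eval₂_at_zero, hg.2.1]
  | succ n ih =>
    have := (padicValNat_den_eval_add p g hg.1 (hc.trans_le ih) ih).1
    rw [← gcIter_succ] at this
    exact ih.trans this.le

/-- Lemma 2.9: if `p ∈ I(B_n)`, i.e. `val_p(B_n) > val_p(u_d)`, then `p ∈ I(B_{n+1})`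
and `val_p(B_{n+1}) = d · val_p(B_n) − val_p(u_d)`. -/
theorem valuation_Bn_succ (g : ℤ[X]) (hg : IsX2Divisible g) (c : ℚ) (n : ℕ)
    (p : ℕ) (hp : p.Prime)
    (h : padicValInt p g.leadingCoeff < padicValNat p (Bn g c n)) :
    padicValInt p g.leadingCoeff < padicValNat p (Bn g c (n + 1)) ∧
    (padicValNat p (Bn g c (n + 1)) : ℤ) =
      (g.natDegree : ℤ) * padicValNat p (Bn g c n) - padicValInt p g.leadingCoeff := by
  have : Fact p.Prime := ⟨hp⟩
  have hc : padicValNat p c.den ≤ padicValNat p (Bn g c n) := by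
    by_cases hce : padicValInt p g.leadingCoeff < padicValNat p c.den
    · exact padicValNat_den_le_Bn p g hg hce n
    · omega
  have key := padicValNat_den_eval_add p g hg.1 h hc
  rw [← gcIter_succ] at key
  exact ⟨h.trans key.1, key.2⟩
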